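/- arXiv:math/0506618 — 3 statements merged into one kernel-verified Lean document; each statement's English description precedes it below -/
import Mathlib

section
/- For all integers m ≥ 3 and n ≥ 0, with N = 2(3^{m−1} + 2n − 1): the vertex sets of the faces F_i, i ∈ ℤ/Nℤ, are pairwise distinct (so there are exactly N faces), and every element v ∈ ℤ/Nℤ lies in the vertex set of exactly 2m−1 of the faces F_j. -/
/-- The sequence `b` : `b (2l-1) = 3^(l-1) - 1`, `b (2l) = 2·3^(l-1) - 1` (for `k ≥ 1`). -/
def bseq (k : ℕ) : ℤ := if k % 2 = 1 then 3 ^ (k / 2) - 1 else 2 * 3 ^ (k / 2 - 1) - 1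

/-- Offsets of the face `F_i` in the odd case `M_{2m-1, 2(3^{m-1}+2n-1)}`. -/
def oddOff (m n k : ℕ) : ℤ :=
  bseq k + (if k = 2 * m - 2 then (n : ℤ) else if k = 2 * m - 1 then 2 * (n : ℤ) else 0)

/-- The entries of the face `F_i` (odd case). -/
def Fface (m n : ℕ) (i : ZMod (2 * (3 ^ (m - 1) + 2 * n - 1))) :
    Fin (2 * m - 1) → ZMod (2 * (3 ^ (m - 1) + 2 * n - 1)) :=
  fun j => i + (oddOff m n (j.1 + 1) : ZMod (2 * (3 ^ (m - 1) + 2 * n - 1)))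

theorem bseq_lt_bseq_succ {k : ℕ} (hk : 1 ≤ k) : bseq k < bseq (k + 1) := by
  obtain ⟨l, rfl | rfl⟩ := Nat.even_or_odd' k
  · obtain ⟨l, rfl⟩ : ∃ r, l = r + 1 := ⟨l - 1, by omega⟩
    have h₁ : (2 * (l + 1)) % 2 = 0 := by omega
    have h₂ : (2 * (l + 1) + 1) % 2 = 1 := by omega
    have h₃ : (2 * (l + 1)) / 2 = l + 1 := by omega
    have h₄ : (2 * (l + 1) + 1) / 2 = l + 1 := by omega
    have h₅ : (0 : ℤ) < 3 ^ l := by positivity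
    simp only [bseq, h₁, h₂, h₃, h₄, pow_succ, Nat.add_sub_cancel]
    norm_num
    linarith
  · have h₁ : (2 * l + 1) % 2 = 1 := by omega
    have h₂ : (2 * l + 1 + 1) % 2 = 0 := by omega
    have h₃ : (2 * l + 1) / 2 = l := by omega
    have h₄ : (2 * l + 1 + 1) / 2 = l + 1 := by omega
    simp only [bseq, h₁, h₂, h₃, h₄, Nat.add_sub_cancel]
    norm_num

theorem strictMono_bseq_succ : StrictMono fun k => bseq (k + 1) :=
  strictMono_nat_of_lt_succ fun _ => bseq_lt_bseq_succ (Nat.succ_pos _)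

theorem strictMono_oddOff_succ (m n : ℕ) :
    StrictMono fun j : Fin (2 * m - 1) => oddOff m n (j.1 + 1) := by
  intro a b hab
  have hb := b.2
  have hlt : bseq (a.1 + 1) < bseq (b.1 + 1) := strictMono_bseq_succ hab
  have hab' : a.1 < b.1 := hab
  simp only [oddOff]
  split_ifs <;> omega

theorem oddOff_one {m : ℕ} (n : ℕ) (hm : 3 ≤ m) : oddOff m n 1 = 0 := by
  have h₁ : 1 ≠ 2 * m - 2 := by omega
  have h₂ : 1 ≠ 2 * m - 1 := by omega
  simp [oddOff, bseq, h₁, h₂]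

theorem oddOff_two {m : ℕ} (n : ℕ) (hm : 3 ≤ m) : oddOff m n 2 = 1 := by
  have h₁ : 2 ≠ 2 * m - 2 := by omega
  have h₂ : 2 ≠ 2 * m - 1 := by omega
  simp [oddOff, bseq, h₁, h₂]

theorem oddOff_last {m : ℕ} (n : ℕ) (hm : 1 ≤ m) :
    oddOff m n (2 * m - 1) = ((3 ^ (m - 1) + 2 * n - 1 : ℕ) : ℤ) := by
  have h₁ : 2 * m - 1 ≠ 2 * m - 2 := by omega
  have h₂ : (2 * m - 1) % 2 = 1 := by omega
  have h₃ : (2 * m - 1) / 2 = m - 1 := by omega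
  have h₄ : 1 ≤ 3 ^ (m - 1) + 2 * n := le_add_right (Nat.one_le_pow _ _ (by norm_num))
  simp only [oddOff, bseq, h₁, h₂, h₃, if_true, if_false]
  push_cast [Nat.cast_sub h₄]
  ring

theorem oddOff_mem_Icc {m : ℕ} (n : ℕ) (hm : 3 ≤ m) (j : Fin (2 * m - 1)) :
    oddOff m n (j.1 + 1) ∈ Set.Icc (0 : ℤ) ((3 ^ (m - 1) + 2 * n - 1 : ℕ) : ℤ) := by
  have hmono := (strictMono_oddOff_succ m n).monotone
  have hj := j.2
  constructor
  · rw [← oddOff_one n hm]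
    exact hmono (a := ⟨0, by omega⟩) (Nat.zero_le _)
  · rw [← oddOff_last n (by omega : 1 ≤ m)]
    have h := hmono (a := j) (b := ⟨2 * m - 2, by omega⟩) (Fin.mk_le_mk.2 (by omega))
    have h' : 2 * m - 2 + 1 = 2 * m - 1 := by omega
    simpa only [h'] using h

/-- A family of residues modulo `2 * H` represented in `[0, H]` and containing `0` and `1` has
trivial translation stabilizer. -/
theorem eq_of_range_add_intCast_eq {ι : Type*} {H : ℕ} (hH : 2 ≤ H) {f : ι → ℤ}
    (hf : ∀ a, f a ∈ Set.Icc (0 : ℤ) H) (h0 : ∃ a, f a = 0) (h1 : ∃ a, f a = 1)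
    {i i' : ZMod (2 * H)}
    (h : (Set.range fun a => i + (f a : ZMod (2 * H))) =
      Set.range fun a => i' + (f a : ZMod (2 * H))) : i = i' := by
  obtain ⟨a₀, h0⟩ := h0
  obtain ⟨a₁, h1⟩ := h1
  obtain ⟨s, hs⟩ : i ∈ Set.range fun a => i' + (f a : ZMod (2 * H)) :=
    h ▸ ⟨a₀, by simp [h0]⟩
  obtain ⟨t, ht⟩ : i' ∈ Set.range fun a => i + (f a : ZMod (2 * H)) :=
    h ▸ ⟨a₀, by simp [h0]⟩
  obtain ⟨u, hu⟩ : i + 1 ∈ Set.range fun a => i' + (f a : ZMod (2 * H)) :=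
    h ▸ ⟨a₁, by simp [h1]⟩
  simp only at hs ht hu
  obtain ⟨hs0, hs1⟩ := hf s
  obtain ⟨ht0, ht1⟩ := hf t
  obtain ⟨hu0, hu1⟩ := hf u
  have hdvd : ((2 * H : ℕ) : ℤ) ∣ f s + f t := by
    rw [← ZMod.intCast_zmod_eq_zero_iff_dvd]
    push_cast
    linear_combination hs + ht
  have hdvd' : ((2 * H : ℕ) : ℤ) ∣ f s + 1 - f u := by
    rw [← ZMod.intCast_zmod_eq_zero_iff_dvd]
    push_cast
    linear_combination hs - hu
  have hst : f s = 0 ∨ f s = H := by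
    by_contra! hne
    have := Int.le_of_dvd (by omega) hdvd
    omega
  rcases hst with hs' | hs'
  · simpa [hs'] using hs.symm
  · have := Int.le_of_dvd (by omega) hdvd'
    omega

theorem injective_intCast_of_mem_Icc {ι : Type*} {H : ℕ} (hH : 1 ≤ H) {f : ι → ℤ}
    (hf : ∀ a, f a ∈ Set.Icc (0 : ℤ) H) (hinj : Function.Injective f) :
    Function.Injective fun a => (f a : ZMod (2 * H)) := by
  intro a b hab
  obtain ⟨ha0, ha1⟩ := hf a
  obtain ⟨hb0, hb1⟩ := hf b
  have hdvd := (ZMod.intCast_eq_intCast_iff_dvd_sub _ _ _).1 hab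
  have := Int.eq_zero_of_abs_lt_dvd hdvd (by rw [abs_lt]; push_cast; constructor <;> linarith)
  exact hinj (by omega)

theorem Nat.card_mem_range_add {ι G : Type*} [AddCommGroup G] {g : ι → G}
    (hg : Function.Injective g) (v : G) :
    Nat.card {j : G // v ∈ Set.range fun a => j + g a} = Nat.card ι := by
  refine (Nat.card_congr (Equiv.ofBijective
    (fun a => ⟨v - g a, a, sub_add_cancel v (g a)⟩) ⟨fun a b hab => ?_, ?_⟩)).symm
  · exact hg (sub_right_injective (Subtype.ext_iff.1 hab))
  · rintro ⟨j, a, rfl⟩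
    exact ⟨a, Subtype.ext (add_sub_cancel_right j (g a))⟩

/-- for `m ≥ 3`, `n ≥ 0`, `N = 2(3^{m-1}+2n-1)`: the vertex sets of the faces
`F_i`, `i ∈ ℤ/Nℤ`, are pairwise distinct (so there are exactly `N` faces), and every
`v ∈ ℤ/Nℤ` lies in the vertex set of exactly `2m-1` of the faces `F_j`. -/
theorem Fface_vertexSets_distinct_and_degree (m n : ℕ) (hm : 3 ≤ m) :
    (∀ i i' : ZMod (2 * (3 ^ (m - 1) + 2 * n - 1)),
      Set.range (Fface m n i) = Set.range (Fface m n i') → i = i') ∧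
    (∀ v : ZMod (2 * (3 ^ (m - 1) + 2 * n - 1)),
      Nat.card {j : ZMod (2 * (3 ^ (m - 1) + 2 * n - 1)) //
        v ∈ Set.range (Fface m n j)} = 2 * m - 1) := by
  have hpow : 3 ^ 2 ≤ 3 ^ (m - 1) := Nat.pow_le_pow_right (by norm_num) (by omega)
  have hH : 2 ≤ 3 ^ (m - 1) + 2 * n - 1 := by omega
  have hf := oddOff_mem_Icc n hm
  refine ⟨fun i i' h => ?_, fun v => ?_⟩
  · exact eq_of_range_add_intCast_eq hH hf ⟨⟨0, by omega⟩, oddOff_one n hm⟩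
      ⟨⟨1, by omega⟩, oddOff_two n hm⟩ h
  · exact (Nat.card_mem_range_add (injective_intCast_of_mem_Icc (by omega) hf
      (strictMono_oddOff_succ m n).injective) v).trans (Nat.card_fin _)
end

section
/- (Self-duality, even case, Lemma 3.) For all integers m ≥ 3 and n ≥ 0, with η = 3^m + 2n − 1, and for all i, v, v′ ∈ ℤ/ηℤ: (a) v lies in the vertex set of C_i if and only if −i lies in the vertex set of C_{−v}; (b) if {v, v′} is an edge of C_i, then the vertex sets of C_{−v} and C_{−v′} both contain −i and intersect in exactly two elements. (Hence the bijection v ↦ C_{−v} carries each face C_i of the map to a cycle of pairwise-adjacent faces through the vertex −i, i.e., to a face of the dual map, so the map M_{2m, η} is self dual.) -/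
/-- Offsets of the face `C_i` in the even case `M_{2m, 3^m+2n-1}`. -/
def evenOff (m n k : ℕ) : ℤ := bseq k + (if k = 2 * m then (n : ℤ) else 0)

/-- The entries of the face `C_i` (even case). -/
def Cface (m n : ℕ) (i : ZMod (3 ^ m + 2 * n - 1)) :
    Fin (2 * m) → ZMod (3 ^ m + 2 * n - 1) :=
  fun j => i + (evenOff m n (j.1 + 1) : ZMod (3 ^ m + 2 * n - 1))

/-- `e` is an edge of the face `C_j`: a set of two cyclically consecutive entries. -/
def IsCedge (m n : ℕ) (j : ZMod (3 ^ m + 2 * n - 1))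
    (e : Set (ZMod (3 ^ m + 2 * n - 1))) : Prop :=
  ∃ t : Fin (2 * m), e = {Cface m n j t, Cface m n j (finRotate (2 * m) t)}

/-- The integers occurring as offsets of the faces: `3^l - 1` for `l < m`, `2·3^l - 1` for
`l + 1 < m`, and the shifted last offset `2·3^(m-1) - 1 + n`. -/
def IsEvenOff (m n : ℕ) (d : ℤ) : Prop :=
  (∃ l < m, d = 3 ^ l - 1) ∨ (∃ l, l + 1 < m ∧ d = 2 * 3 ^ l - 1) ∨
    ∃ l, l + 1 = m ∧ d = 2 * 3 ^ l - 1 + n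

theorem evenOff_two_mul_add_one (m n l : ℕ) : evenOff m n (2 * l + 1) = 3 ^ l - 1 := by
  have h : ¬ 2 * l + 1 = 2 * m := by omega
  have h₁ : (2 * l + 1) % 2 = 1 := by omega
  have h₂ : (2 * l + 1) / 2 = l := by omega
  simp [evenOff, bseq, h, h₁, h₂]

theorem evenOff_two_mul_add_two (m n l : ℕ) :
    evenOff m n (2 * l + 2) = 2 * 3 ^ l - 1 + if l + 1 = m then (n : ℤ) else 0 := by
  have h : 2 * l + 2 = 2 * m ↔ l + 1 = m := by omega
  have h₁ : ¬ (2 * l + 2) % 2 = 1 := by omega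
  have h₂ : (2 * l + 2) / 2 - 1 = l := by omega
  simp only [evenOff, bseq, h, h₁, h₂, if_false]

theorem isEvenOff_iff (m n : ℕ) (d : ℤ) :
    IsEvenOff m n d ↔ ∃ j : Fin (2 * m), d = evenOff m n (j.1 + 1) := by
  constructor
  · rintro (⟨l, hl, rfl⟩ | ⟨l, hl, rfl⟩ | ⟨l, hl, rfl⟩)
    · exact ⟨⟨2 * l, by omega⟩, (evenOff_two_mul_add_one m n l).symm⟩
    · refine ⟨⟨2 * l + 1, by omega⟩, ?_⟩
      rw [evenOff_two_mul_add_two, if_neg hl.ne, add_zero]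
    · refine ⟨⟨2 * l + 1, by omega⟩, ?_⟩
      rw [evenOff_two_mul_add_two, if_pos hl]
  · rintro ⟨⟨j, hj⟩, rfl⟩
    obtain ⟨l, rfl | rfl⟩ := Nat.even_or_odd' j
    · exact Or.inl ⟨l, by omega, evenOff_two_mul_add_one m n l⟩
    · have h := evenOff_two_mul_add_two m n l
      by_cases hl : l + 1 = m
      · rw [if_pos hl] at h
        exact Or.inr (Or.inr ⟨l, hl, h⟩)
      · rw [if_neg hl, add_zero] at h
        exact Or.inr (Or.inl ⟨l, by omega, h⟩)

theorem mem_range_Cface (m n : ℕ) (i x : ZMod (3 ^ m + 2 * n - 1)) :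
    x ∈ Set.range (Cface m n i) ↔ ∃ d, IsEvenOff m n d ∧ x = i + d := by
  simp only [isEvenOff_iff]
  constructor
  · rintro ⟨j, rfl⟩
    exact ⟨_, ⟨j, rfl⟩, rfl⟩
  · rintro ⟨_, ⟨j, rfl⟩, rfl⟩
    exact ⟨j, rfl⟩

theorem mem_range_Cface_iff_neg_mem (m n : ℕ) (i v : ZMod (3 ^ m + 2 * n - 1)) :
    v ∈ Set.range (Cface m n i) ↔ -i ∈ Set.range (Cface m n (-v)) := by
  simp only [mem_range_Cface]
  refine exists_congr fun d => and_congr_right fun _ => ?_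
  constructor <;> intro h <;> linear_combination h

theorem IsEvenOff.bounds {k n : ℕ} {d : ℤ} (h : IsEvenOff (k + 1) n d) :
    0 ≤ d ∧ (d ≤ 3 ^ k - 1 ∨ d = 2 * 3 ^ k - 1 + n) := by
  have hpos (l : ℕ) : (1 : ℤ) ≤ 3 ^ l := one_le_pow₀ (by norm_num)
  obtain ⟨l, hl, rfl⟩ | ⟨l, hl, rfl⟩ | ⟨l, hl, rfl⟩ := h
  · have : (3 : ℤ) ^ l ≤ 3 ^ k := pow_le_pow_right₀ (by norm_num) (by omega)
    have := hpos l
    exact ⟨by omega, Or.inl (by omega)⟩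
  · have : (3 : ℤ) ^ (l + 1) ≤ 3 ^ k := pow_le_pow_right₀ (by norm_num) (by omega)
    have := hpos l
    rw [pow_succ] at *
    exact ⟨by omega, Or.inl (by omega)⟩
  · obtain rfl : l = k := by omega
    have := hpos l
    exact ⟨by omega, Or.inr rfl⟩

theorem three_pow_le_or (a b : ℕ) : (3 : ℤ) ^ a ≤ 3 ^ b ∨ 3 * (3 : ℤ) ^ b ≤ 3 ^ a := by
  rcases le_or_gt a b with h | h
  · exact Or.inl (pow_le_pow_right₀ (by norm_num) h)
  · right
    rw [← pow_succ']
    exact pow_le_pow_right₀ (by norm_num) h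

/-- A power of three is a difference of two numbers of the form `3^a` or `2·3^a`
in only two ways. -/
theorem eq_or_eq_of_sub_eq_three_pow {x y : ℤ} {l : ℕ}
    (hx : ∃ a : ℕ, x = 3 ^ a ∨ x = 2 * 3 ^ a) (hy : ∃ a : ℕ, y = 3 ^ a ∨ y = 2 * 3 ^ a)
    (h : y - x = 3 ^ l) : x = 3 ^ l ∨ x = 2 * 3 ^ l := by
  have hpos (l : ℕ) : (1 : ℤ) ≤ 3 ^ l := one_le_pow₀ (by norm_num)
  have hodd (l : ℕ) : (3 : ℤ) ^ l % 2 = 1 := Int.odd_iff.mp (Odd.pow (by decide))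
  obtain ⟨b, hb⟩ := hx
  obtain ⟨a, ha⟩ := hy
  have := hpos a
  have := hpos b
  have := hpos l
  have := hodd a
  have := hodd b
  have := hodd l
  have := three_pow_le_or b a
  have := three_pow_le_or l a
  have := three_pow_le_or a b
  have := three_pow_le_or a l
  generalize (3 : ℤ) ^ a = A at *
  generalize (3 : ℤ) ^ b = B at *
  generalize (3 : ℤ) ^ l = L at *
  omega

/-- Two integers congruent modulo `η`, one in `(0, η)`, the other in `(-η, η)`. -/
theorem eq_or_eq_sub_of_dvd {η x y : ℤ} (hx : 0 < x) (hxη : x < η) (hy : -η < y) (hyη : y < η)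
    (h : η ∣ y - x) : y = x ∨ y = x - η := by
  obtain ⟨t, ht⟩ := h
  have h₁ : t < 1 := by nlinarith
  have h₂ : -2 < t := by nlinarith
  obtain rfl | rfl : t = 0 ∨ t = -1 := by omega
  · left; linarith
  · right; linarith

theorem cast_modulus (k n : ℕ) :
    ((3 ^ (k + 1) + 2 * n - 1 : ℕ) : ℤ) = 3 * 3 ^ k + 2 * n - 1 := by
  have : 1 ≤ 3 ^ (k + 1) := Nat.one_le_pow _ _ (by norm_num)
  rw [Nat.cast_sub (by omega)]
  push_cast
  ring

theorem IsEvenOff.sub_eq_or {k n : ℕ} {d d' e : ℤ} (hd : IsEvenOff (k + 1) n d)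
    (hd' : IsEvenOff (k + 1) n d') (he : 0 < e) (he' : e ≤ 3 ^ k + n) (hk : 1 ≤ k)
    (h : (d' - d : ZMod (3 ^ (k + 1) + 2 * n - 1)) = e) :
    d' - d = e ∨ d' - d = e - (3 * 3 ^ k + 2 * n - 1) := by
  have hpos : (3 : ℤ) ^ 1 ≤ 3 ^ k := pow_le_pow_right₀ (by norm_num) hk
  have := hd.bounds
  have := hd'.bounds
  rw [← Int.cast_sub, eq_comm, ZMod.intCast_eq_intCast_iff_dvd_sub, cast_modulus] at h
  exact eq_or_eq_sub_of_dvd he (by omega) (by omega) (by omega) h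

theorem IsEvenOff.eq_or_eq_of_sub_eq_three_pow {k n l : ℕ} {d d' : ℤ}
    (hd : IsEvenOff (k + 1) n d) (hd' : IsEvenOff (k + 1) n d') (hl : l < k)
    (h : (d' - d : ZMod (3 ^ (k + 1) + 2 * n - 1)) = ((3 ^ l : ℤ) :)) :
    d = 3 ^ l - 1 ∨ d = 2 * 3 ^ l - 1 := by
  have hpos : (1 : ℤ) ≤ 3 ^ l := one_le_pow₀ (by norm_num)
  have hlk : (3 : ℤ) ^ (l + 1) ≤ 3 ^ k := pow_le_pow_right₀ (by norm_num) hl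
  rw [pow_succ] at hlk
  have hb := hd.bounds
  have hb' := hd'.bounds
  obtain h | h := hd.sub_eq_or hd' (by omega) (by omega) (by omega) h
  · have key {x : ℤ} (hx : IsEvenOff (k + 1) n x) (hxk : x ≤ 3 ^ k - 1) :
        ∃ a : ℕ, x + 1 = 3 ^ a ∨ x + 1 = 2 * 3 ^ a := by
      obtain ⟨a, -, rfl⟩ | ⟨a, -, rfl⟩ | ⟨a, ha, rfl⟩ := hx
      · exact ⟨a, by omega⟩
      · exact ⟨a, by omega⟩
      · obtain rfl : a = k := by omega
        omega
    have := _root_.eq_or_eq_of_sub_eq_three_pow (key hd (by omega)) (key hd' (by omega))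
      (l := l) (by omega)
    omega
  · omega

theorem IsEvenOff.eq_or_eq_of_sub_eq_last {k n : ℕ} {d d' : ℤ}
    (hd : IsEvenOff (k + 1) n d) (hd' : IsEvenOff (k + 1) n d') (hk : 1 ≤ k)
    (h : (d' - d : ZMod (3 ^ (k + 1) + 2 * n - 1)) = ((3 ^ k + n : ℤ) :)) :
    d = 3 ^ k - 1 ∨ d = 2 * 3 ^ k - 1 + n := by
  have hpos : (3 : ℤ) ^ 1 ≤ 3 ^ k := pow_le_pow_right₀ (by norm_num) hk
  have hb := hd.bounds
  have hb' := hd'.bounds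
  obtain h | h := hd.sub_eq_or hd' (by omega) le_rfl hk h <;> omega

/-- If `a, b, c` are offsets with `b - a = c - b`, and this difference arises from `a, b` and
`b, c` only, then any two faces shifted by it share exactly two vertices. -/
theorem ncard_inter_range_Cface {m n : ℕ} {a b c : ℤ} (ha : IsEvenOff m n a)
    (hb : IsEvenOff m n b) (hc : IsEvenOff m n c)
    (hbc : (b - a : ZMod (3 ^ m + 2 * n - 1)) = c - b)
    (hab : (a : ZMod (3 ^ m + 2 * n - 1)) ≠ b)
    (huniq : ∀ d d' : ℤ, IsEvenOff m n d → IsEvenOff m n d' →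
      (d' - d : ZMod (3 ^ m + 2 * n - 1)) = b - a → d = a ∨ d = b)
    {v v' : ZMod (3 ^ m + 2 * n - 1)} (hv : v' - v = b - a) :
    (Set.range (Cface m n (-v)) ∩ Set.range (Cface m n (-v'))).ncard = 2 := by
  have : Set.range (Cface m n (-v)) ∩ Set.range (Cface m n (-v')) =
      {-v + (a : ZMod (3 ^ m + 2 * n - 1)), -v + (b : ZMod (3 ^ m + 2 * n - 1))} := by
    ext x
    simp only [Set.mem_inter_iff, mem_range_Cface, Set.mem_insert_iff, Set.mem_singleton_iff]
    constructor
    · rintro ⟨⟨d, hd, rfl⟩, d', hd', h⟩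
      obtain rfl | rfl := huniq d d' hd hd' (by linear_combination hv - h)
      · exact Or.inl rfl
      · exact Or.inr rfl
    · rintro (rfl | rfl)
      · exact ⟨⟨a, ha, rfl⟩, b, hb, by linear_combination hv⟩
      · exact ⟨⟨b, hb, rfl⟩, c, hc, by linear_combination hv + hbc⟩
  rw [this, Set.ncard_pair]
  simpa using hab

theorem ncard_inter_of_sub_eq_three_pow {k n l : ℕ} (hl : l < k)
    {v v' : ZMod (3 ^ (k + 1) + 2 * n - 1)} (hv : v' - v = ((3 ^ l : ℤ) :)) :
    (Set.range (Cface (k + 1) n (-v)) ∩ Set.range (Cface (k + 1) n (-v'))).ncard = 2 := by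
  have hpos : (1 : ℤ) ≤ 3 ^ l := one_le_pow₀ (by norm_num)
  have hlk : (3 : ℤ) ^ (l + 1) ≤ 3 ^ k := pow_le_pow_right₀ (by norm_num) hl
  rw [pow_succ] at hlk
  refine ncard_inter_range_Cface (a := 3 ^ l - 1) (b := 2 * 3 ^ l - 1) (c := 3 ^ (l + 1) - 1)
    (Or.inl ⟨l, by omega, rfl⟩) (Or.inr (Or.inl ⟨l, by omega, rfl⟩))
    (Or.inl ⟨l + 1, by omega, rfl⟩) (by push_cast; ring) ?_ ?_ ?_
  · rw [Ne, ZMod.intCast_eq_intCast_iff_dvd_sub, cast_modulus]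
    intro h
    have := Int.le_of_dvd (by omega) h
    omega
  · intro d d' hd hd' h
    exact hd.eq_or_eq_of_sub_eq_three_pow hd' hl (by rw [h]; push_cast; ring)
  · rw [hv]; push_cast; ring

theorem ncard_inter_of_sub_eq_last {k n : ℕ} (hk : 1 ≤ k)
    {v v' : ZMod (3 ^ (k + 1) + 2 * n - 1)} (hv : v' - v = ((3 ^ k + n : ℤ) :)) :
    (Set.range (Cface (k + 1) n (-v)) ∩ Set.range (Cface (k + 1) n (-v'))).ncard = 2 := by
  have hpos : (3 : ℤ) ^ 1 ≤ 3 ^ k := pow_le_pow_right₀ (by norm_num) hk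
  have hη : ((3 * 3 ^ k + 2 * n - 1 : ℤ) : ZMod (3 ^ (k + 1) + 2 * n - 1)) = 0 := by
    rw [← cast_modulus, Int.cast_natCast, ZMod.natCast_self]
  push_cast at hη
  refine ncard_inter_range_Cface (a := 3 ^ k - 1) (b := 2 * 3 ^ k - 1 + n) (c := 3 ^ 0 - 1)
    (Or.inl ⟨k, by omega, rfl⟩) (Or.inr (Or.inr ⟨k, rfl, rfl⟩))
    (Or.inl ⟨0, by omega, rfl⟩) (by push_cast; linear_combination hη) ?_ ?_ ?_
  · rw [Ne, ZMod.intCast_eq_intCast_iff_dvd_sub, cast_modulus]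
    intro h
    have := Int.le_of_dvd (by omega) h
    omega
  · intro d d' hd hd' h
    exact hd.eq_or_eq_of_sub_eq_last hd' hk (by rw [h]; push_cast; ring)
  · rw [hv]; push_cast; ring

theorem val_finRotate {N : ℕ} (t : Fin N) :
    (finRotate N t : ℕ) = if (t : ℕ) + 1 = N then 0 else (t : ℕ) + 1 := by
  cases N with
  | zero => exact t.elim0
  | succ N => rw [coe_finRotate]; simp only [Fin.ext_iff, Fin.val_last, Nat.add_right_cancel_iff]

/-- Consecutive entries of a face differ by `3^l` with `l < k`, or by `3^k + n`. -/
theorem Cface_finRotate_sub (k n : ℕ) (i : ZMod (3 ^ (k + 1) + 2 * n - 1))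
    (t : Fin (2 * (k + 1))) :
    (∃ l < k, Cface (k + 1) n i (finRotate _ t) - Cface (k + 1) n i t = ((3 ^ l : ℤ) :)) ∨
      Cface (k + 1) n i (finRotate _ t) - Cface (k + 1) n i t = ((3 ^ k + n : ℤ) :) := by
  have hη : ((3 * 3 ^ k + 2 * n - 1 : ℤ) : ZMod (3 ^ (k + 1) + 2 * n - 1)) = 0 := by
    rw [← cast_modulus, Int.cast_natCast, ZMod.natCast_self]
  push_cast at hη
  simp only [Cface, val_finRotate]
  obtain ⟨j, hj⟩ := t
  obtain ⟨l, rfl | rfl⟩ := Nat.even_or_odd' j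
  · rw [if_neg (by simp only; omega)]
    simp only [evenOff_two_mul_add_one]
    rw [show 2 * l + 1 + 1 = 2 * l + 2 from rfl, evenOff_two_mul_add_two]
    by_cases hl : l = k
    · subst hl
      right
      rw [if_pos rfl]
      push_cast
      ring
    · left
      refine ⟨l, by omega, ?_⟩
      rw [if_neg (by omega)]
      push_cast
      ring
  · simp only
    rw [show 2 * l + 1 + 1 = 2 * l + 2 from rfl, evenOff_two_mul_add_two]
    by_cases hl : l = k
    · subst hl
      right
      rw [if_pos (by omega), if_pos rfl, evenOff_two_mul_add_one _ _ 0]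
      push_cast
      linear_combination -hη
    · left
      refine ⟨l, by omega, ?_⟩
      rw [if_neg (by omega), if_neg (by omega), show 2 * l + 2 + 1 = 2 * (l + 1) + 1 from rfl,
        evenOff_two_mul_add_one]
      push_cast
      ring

theorem ncard_inter_range_Cface_finRotate {m : ℕ} (n : ℕ) (hm : 3 ≤ m)
    (i : ZMod (3 ^ m + 2 * n - 1)) (t : Fin (2 * m)) :
    (Set.range (Cface m n (-Cface m n i t)) ∩
      Set.range (Cface m n (-Cface m n i (finRotate _ t)))).ncard = 2 := by
  obtain ⟨k, rfl⟩ : ∃ k, m = k + 1 := ⟨m - 1, by omega⟩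
  obtain ⟨l, hl, h⟩ | h := Cface_finRotate_sub k n i t
  · exact ncard_inter_of_sub_eq_three_pow hl h
  · exact ncard_inter_of_sub_eq_last (by omega) h

/-- self-duality, even case, Lemma 3: for `m ≥ 3`, `n ≥ 0`,
`η = 3^m + 2n - 1` and all `i, v, v' ∈ ℤ/ηℤ`:
(a) `v` is a vertex of `C_i` iff `-i` is a vertex of `C_{-v}`;
(b) if `{v, v'}` is an edge of `C_i` then `C_{-v}` and `C_{-v'}` both contain the vertex
`-i` and their vertex sets intersect in exactly two elements. -/
theorem Cface_self_dual (m n : ℕ) (hm : 3 ≤ m)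
    (i v v' : ZMod (3 ^ m + 2 * n - 1)) :
    (v ∈ Set.range (Cface m n i) ↔ -i ∈ Set.range (Cface m n (-v))) ∧
    (v ≠ v' → IsCedge m n i {v, v'} →
      -i ∈ Set.range (Cface m n (-v)) ∧ -i ∈ Set.range (Cface m n (-v')) ∧
      (Set.range (Cface m n (-v)) ∩ Set.range (Cface m n (-v'))).ncard = 2) := by
  refine ⟨mem_range_Cface_iff_neg_mem m n i v, ?_⟩
  rintro - ⟨t, ht⟩
  obtain ⟨rfl, rfl⟩ | ⟨rfl, rfl⟩ := Set.pair_eq_pair_iff.mp ht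
  · exact ⟨(mem_range_Cface_iff_neg_mem ..).mp ⟨t, rfl⟩,
      (mem_range_Cface_iff_neg_mem ..).mp ⟨_, rfl⟩,
      ncard_inter_range_Cface_finRotate n hm i t⟩
  · refine ⟨(mem_range_Cface_iff_neg_mem ..).mp ⟨_, rfl⟩,
      (mem_range_Cface_iff_neg_mem ..).mp ⟨t, rfl⟩, ?_⟩
    rw [Set.inter_comm]
    exact ncard_inter_range_Cface_finRotate n hm i t
end

section
/- (Key arithmetic step of Lemma 4, odd case.) For all integers m > 5 and n ≥ 0, with N = 2(3^{m−1} + 2n − 1) and b_k as defined: 1 + b_4 − b_{m+3} is not congruent to −b_{m+1} modulo N. (This non-congruence yields the contradiction showing that no automorphism of M_{2m−1, N} carries the flag (0, {0, b_m − b_{m+1}}, F_{−b_{m+1}}) to the flag (0, {0, b_{m+2} − b_{m+1}}, F_{−b_{m+1}}), so M_{2m−1, N} is not combinatorially regular.) -/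
lemma bseq_odd (j : ℕ) : bseq (2 * j + 1) = 3 ^ j - 1 := by
  have h : (2 * j + 1) % 2 = 1 := by omega
  have h' : (2 * j + 1) / 2 = j := by omega
  simp [bseq, h, h']

lemma bseq_even (j : ℕ) : bseq (2 * j + 2) = 2 * 3 ^ j - 1 := by
  have h : (2 * j + 2) % 2 = 0 := by omega
  have h' : (2 * j + 2) / 2 - 1 = j := by omega
  simp only [bseq, h, h']
  simp

/-- key arithmetic step of Lemma 4, odd case: for `m > 5` and `n ≥ 0`,
with `N = 2(3^{m-1}+2n-1)`, one has `1 + b_4 - b_{m+3} ≢ -b_{m+1} (mod N)`. -/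
theorem odd_not_regular_arith (m n : ℕ) (hm : 5 < m) :
    ¬ (1 + bseq 4 - bseq (m + 3) ≡ -bseq (m + 1)
        [ZMOD ((2 * (3 ^ (m - 1) + 2 * n - 1) : ℕ) : ℤ)]) := by
  intro h
  have hdvd := h.dvd
  have h4 : bseq 4 = 5 := by simpa using bseq_even 1
  have hN : ((2 * (3 ^ (m - 1) + 2 * n - 1) : ℕ) : ℤ) = 2 * (3 ^ (m - 1) + 2 * n - 1) := by
    have : 1 ≤ 3 ^ (m - 1) + 2 * n := le_add_right (Nat.one_le_pow _ _ (by norm_num))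
    push_cast [Nat.cast_sub this]
    ring
  rw [hN, h4] at hdvd
  have hn : (0 : ℤ) ≤ n := Int.natCast_nonneg n
  obtain ⟨j, rfl | rfl⟩ := Nat.even_or_odd' m
  · have hj : (3 : ℤ) ^ 3 ≤ 3 ^ j := pow_le_pow_right₀ (by norm_num) (by omega)
    have hpow : (3 : ℤ) * 3 ^ (2 * j - 1) = 3 ^ j * 3 ^ j := by
      rw [← pow_succ', ← pow_add]
      congr 1
      omega
    rw [bseq_odd, show 2 * j + 3 = 2 * (j + 1) + 1 by ring, bseq_odd, pow_succ] at hdvd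
    have := Int.le_of_dvd (by linarith) hdvd
    nlinarith
  · have hj : (3 : ℤ) ^ 3 ≤ 3 ^ j := pow_le_pow_right₀ (by norm_num) (by omega)
    have hpow : (3 : ℤ) ^ (2 * j + 1 - 1) = 3 ^ j * 3 ^ j := by
      rw [← pow_add]
      congr 1
      omega
    rw [show 2 * j + 1 + 1 = 2 * j + 2 by ring, bseq_even,
      show 2 * j + 1 + 3 = 2 * (j + 1) + 2 by ring, bseq_even, pow_succ] at hdvd
    have := Int.le_of_dvd (by linarith) hdvd
    nlinarith
end
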